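/- arXiv:0907.2430 — 2 statements merged into one kernel-verified Lean document; each statement's English description precedes it below -/
import Mathlib

section
/- A sequence s : ℕ → {0,1} has complexity p(k) = k + 1 for every k ≥ 1 (i.e., s is Sturmian) if and only if there exist an irrational real number α > 0 and a real number ρ such that either s(n) = 0 when ⌊(n+1)α + ρ⌋ − ⌊nα + ρ⌋ = ⌊α⌋ and s(n) = 1 otherwise, for all n ≥ 0; or s(n) = 0 when ⌈(n+1)α + ρ⌉ − ⌈nα + ρ⌉ = ⌊α⌋ and s(n) = 1 otherwise, for all n ≥ 0. -/
/-- The finite word `s(i) s(i+1) ⋯ s(i+k−1)`. -/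
def window {A : Type*} (s : ℕ → A) (i k : ℕ) : List A :=
  (List.range k).map fun j => s (i + j)

/-- `l` is a factor of the sequence `s`. -/
def IsFactor {A : Type*} (s : ℕ → A) (l : List A) : Prop :=
  ∃ i, l = window s i l.length

/-- The number of distinct factors of `s` of length `k` (complexity function). -/
noncomputable def complexity {A : Type*} (s : ℕ → A) (k : ℕ) : ℕ :=
  Set.ncard {l : List A | l.length = k ∧ IsFactor s l}

/-- The shift map. -/
def shiftMap {A : Type*} (s : ℕ → A) : ℕ → A := fun n => s (n + 1)

/-- The sequence `x·u`. -/
def pre {A : Type*} (x : A) (u : ℕ → A) : ℕ → A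
  | 0 => x
  | n + 1 => u n

/-- Strict lexicographic order on sequences. -/
def SeqLt {A : Type*} [LT A] (u v : ℕ → A) : Prop :=
  ∃ i, (∀ j < i, u j = v j) ∧ u i < v i

/-- Lexicographic order on sequences. -/
def SeqLe {A : Type*} [LT A] (u v : ℕ → A) : Prop :=
  (∀ n, u n = v n) ∨ SeqLt u v

/-- Lexicographic order on (equal-length) finite words. -/
def WordLe {A : Type*} [LT A] (u v : List A) : Prop :=
  u = v ∨ List.Lex (· < ·) u v

def UltimatelyPeriodic {A : Type*} (s : ℕ → A) : Prop :=
  ∃ N, ∃ q ≥ 1, ∀ n ≥ N, s (n + q) = s n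

/-- A binary sequence is Sturmian if it has complexity `k + 1` for all `k ≥ 1`. -/
def Sturmian (s : ℕ → Fin 2) : Prop :=
  ∀ k ≥ 1, complexity s k = k + 1

/-- `w` is a left special factor of `s`. -/
def LeftSpecial {A : Type*} (s : ℕ → A) (w : List A) : Prop :=
  ∃ x y : A, x ≠ y ∧ IsFactor s (x :: w) ∧ IsFactor s (y :: w)

/-- A binary sequence is balanced. -/
def BalancedSeq (s : ℕ → Fin 2) : Prop :=
  ∀ u v : List (Fin 2), IsFactor s u → IsFactor s v → u.length = v.length →
    ((u.count 1 : ℤ) - (v.count 1 : ℤ)).natAbs ≤ 1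

/-- `u` is the characteristic Sturmian sequence of slope `α`. -/
def IsCharSturmian (α : ℝ) (u : ℕ → Fin 2) : Prop :=
  ∀ n : ℕ, ((u n : ℕ) : ℤ) = ⌊((n : ℝ) + 2) * α⌋ - ⌊((n : ℝ) + 1) * α⌋


/-- windows agree -/
def WEq {A : Type*} (s : ℕ → A) (k a b : ℕ) : Prop := ∀ j < k, s (a + j) = s (b + j)

/-- right special at a position -/
def RSp {A : Type*} (s : ℕ → A) (k a : ℕ) : Prop := ∃ b, WEq s k a b ∧ s (a + k) ≠ s (b + k)

lemma window_eq_iff {A : Type*} (s : ℕ → A) (k a b : ℕ) :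
    window s a k = window s b k ↔ WEq s k a b := by
  unfold window WEq
  rw [List.map_inj_left]
  simp

lemma complexity_eq {A : Type*} (s : ℕ → A) (k : ℕ) :
    complexity s k = (Set.range (fun i => window s i k)).ncard := by
  unfold complexity IsFactor
  congr 1
  ext l
  simp only [Set.mem_ofPred_eq, Set.mem_range]
  constructor
  · rintro ⟨rfl, i, h⟩
    exact ⟨i, h.symm⟩
  · rintro ⟨i, rfl⟩
    have : (window s i k).length = k := by simp [window]
    exact ⟨this, i, by rw [this]⟩

lemma range_fin (s : ℕ → Fin 2) (k : ℕ) : (Set.range (fun i => window s i k)).Finite := by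
  refine (List.finite_length_eq (Fin 2) k).subset ?_
  rintro _ ⟨i, rfl⟩
  simp [window]

lemma take_window {A : Type*} (s : ℕ → A) (i k : ℕ) :
    (window s i (k+1)).take k = window s i k := by
  simp [window, List.range_succ]

lemma WEq.symm {A : Type*} {s : ℕ → A} {k a b : ℕ} (h : WEq s k a b) : WEq s k b a :=
  fun j hj => (h j hj).symm

lemma WEq.trans {A : Type*} {s : ℕ → A} {k a b c : ℕ} (h : WEq s k a b) (h' : WEq s k b c) :
    WEq s k a c :=
  fun j hj => (h j hj).trans (h' j hj)

lemma WEq.mono {A : Type*} {s : ℕ → A} {k a b : ℕ} (h : WEq s (k+1) a b) : WEq s k a b :=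
  fun j hj => h j (by omega)

lemma WEq.succ {A : Type*} {s : ℕ → A} {k a b : ℕ} (h : WEq s k a b) (h' : s (a+k) = s (b+k)) :
    WEq s (k+1) a b := by
  intro j hj
  rcases Nat.lt_succ_iff_lt_or_eq.1 hj with h1 | rfl
  · exact h j h1
  · exact h'

lemma WEq.tail {A : Type*} {s : ℕ → A} {k a b : ℕ} (h : WEq s (k+1) a b) :
    WEq s k (a+1) (b+1) := by
  intro j hj
  have := h (j+1) (by omega)
  rwa [show a + 1 + j = a + (j+1) by omega, show b + 1 + j = b + (j+1) by omega]

lemma RSp.congr {A : Type*} {s : ℕ → A} {k a b : ℕ} (hs : RSp s k a) (h : WEq s k a b) :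
    RSp s k b := by
  obtain ⟨c, hc, hne⟩ := hs
  by_cases hb : s (b + k) = s (c + k)
  · exact ⟨a, h.symm, by rw [hb]; exact hne.symm⟩
  · exact ⟨c, h.symm.trans hc, hb⟩

lemma exists_RSp {s : ℕ → Fin 2} {k : ℕ} (h : complexity s k < complexity s (k+1)) :
    ∃ a, RSp s k a := by
  by_contra hc
  push Not at hc
  rw [complexity_eq, complexity_eq] at h
  refine absurd h (not_lt.2 ?_)
  refine Set.ncard_le_ncard_of_injOn (List.take k) ?_ ?_ (range_fin s k)
  · rintro _ ⟨i, rfl⟩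
    exact ⟨i, (take_window s i k).symm⟩
  · rintro _ ⟨a, rfl⟩ _ ⟨b, rfl⟩ hab
    simp only [take_window] at hab ⊢
    rw [window_eq_iff] at hab ⊢
    refine hab.succ ?_
    by_contra hne
    exact hc a ⟨b, hab, hne⟩

lemma lt_of_RSp {s : ℕ → Fin 2} {k a : ℕ} (h : RSp s k a) :
    complexity s k < complexity s (k+1) := by
  obtain ⟨b, hab, hne⟩ := h
  rw [complexity_eq, complexity_eq]
  set R := Set.range (fun i => window s i (k+1)) with hR
  have hb : window s b (k+1) ∈ R := ⟨b, rfl⟩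
  have h1 := Set.ncard_sdiff_singleton_add_one hb (range_fin s (k+1))
  have h2 : (Set.range (fun i => window s i k)).ncard ≤ (R \ {window s b (k+1)}).ncard := by
    refine le_trans (Set.ncard_le_ncard (t := List.take k '' (R \ {window s b (k+1)})) ?_
      (((range_fin s (k+1)).sdiff).image _)) (Set.ncard_image_le ((range_fin s (k+1)).sdiff))
    rintro _ ⟨c, rfl⟩
    by_cases hc : window s c (k+1) = window s b (k+1)
    · refine ⟨window s a (k+1), ⟨⟨a, rfl⟩, ?_⟩, ?_⟩
      · intro h
        rw [Set.mem_singleton_iff, window_eq_iff] at h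
        exact hne (h k (by omega))
      · rw [window_eq_iff] at hc
        simp only [take_window]
        rw [window_eq_iff]
        exact hab.trans hc.mono.symm
    · exact ⟨window s c (k+1), ⟨⟨c, rfl⟩, hc⟩, take_window s c k⟩
  omega

lemma RSp_unique {s : ℕ → Fin 2} {k a a' : ℕ} (h : RSp s k a) (h' : RSp s k a')
    (hp : complexity s (k+1) ≤ complexity s k + 1) : WEq s k a a' := by
  by_contra hn
  obtain ⟨b, hab, hne⟩ := h
  obtain ⟨b', hab', hne'⟩ := h'
  rw [complexity_eq, complexity_eq] at hp
  set R := Set.range (fun i => window s i (k+1)) with hR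
  have hb : window s b (k+1) ∈ R := ⟨b, rfl⟩
  have hb' : window s b' (k+1) ∈ R \ {window s b (k+1)} := by
    refine ⟨⟨b', rfl⟩, ?_⟩
    intro h
    rw [Set.mem_singleton_iff, window_eq_iff] at h
    exact hn (hab.trans (h.mono.symm.trans hab'.symm))
  have h1 := Set.ncard_sdiff_singleton_add_one hb (range_fin s (k+1))
  have h1' := Set.ncard_sdiff_singleton_add_one hb' ((range_fin s (k+1)).sdiff)
  set Q := (R \ {window s b (k+1)}) \ {window s b' (k+1)} with hQ
  have hQf : Q.Finite := ((range_fin s (k+1)).sdiff).sdiff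
  have h2 : (Set.range (fun i => window s i k)).ncard ≤ Q.ncard := by
    refine le_trans (Set.ncard_le_ncard (t := List.take k '' Q) ?_
      (hQf.image _)) (Set.ncard_image_le hQf)
    rintro _ ⟨c, rfl⟩
    by_cases hc : window s c (k+1) = window s b (k+1)
    · refine ⟨window s a (k+1), ⟨⟨⟨a, rfl⟩, ?_⟩, ?_⟩, ?_⟩
      · intro h
        rw [Set.mem_singleton_iff, window_eq_iff] at h
        exact hne (h k (by omega))
      · intro h
        rw [Set.mem_singleton_iff, window_eq_iff] at h
        exact hn (h.mono.trans hab'.symm)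
      · rw [window_eq_iff] at hc
        simp only [take_window]
        rw [window_eq_iff]
        exact hab.trans hc.mono.symm
    by_cases hc' : window s c (k+1) = window s b' (k+1)
    · refine ⟨window s a' (k+1), ⟨⟨⟨a', rfl⟩, ?_⟩, ?_⟩, ?_⟩
      · intro h
        rw [Set.mem_singleton_iff, window_eq_iff] at h
        exact hn (hab.trans h.mono.symm)
      · intro h
        rw [Set.mem_singleton_iff, window_eq_iff] at h
        exact hne' (h k (by omega))
      · rw [window_eq_iff] at hc'
        simp only [take_window]
        rw [window_eq_iff]
        exact hab'.trans hc'.mono.symm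
    · exact ⟨window s c (k+1), ⟨⟨⟨c, rfl⟩, hc⟩, hc'⟩, take_window s c k⟩
  omega

lemma periodic_of_det {s : ℕ → Fin 2} {k m q : ℕ} (hq : 1 ≤ q) (h : WEq s k m (m+q))
    (hn : ∀ t < q, ¬ RSp s k (m+t)) : UltimatelyPeriodic s := by
  have key : ∀ t, WEq s k (m+t) (m+t+q) ∧ ¬ RSp s k (m+t) := by
    intro t
    induction t using Nat.strong_induction_on with
    | _ t ih =>
      have h1 : WEq s k (m+t) (m+t+q) := by
        rcases t with _ | t
        · exact h
        · obtain ⟨h1, h2⟩ := ih t (by omega)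
          have : s (m+t+k) = s (m+t+q+k) := by
            by_contra hne
            exact h2 ⟨_, h1, hne⟩
          have h3 := (h1.succ this).tail
          rwa [show m + t + q + 1 = m + (t+1) + q by omega] at h3
      refine ⟨h1, ?_⟩
      by_cases ht : t < q
      · exact hn t ht
      · obtain ⟨h2, h3⟩ := ih (t-q) (by omega)
        rw [show m + (t-q) + q = m + t by omega] at h2
        intro h4
        exact h3 (h4.congr h2.symm)
  refine ⟨m+k, q, hq, ?_⟩
  intro n hn
  obtain ⟨t, rfl⟩ := Nat.exists_eq_add_of_le hn
  obtain ⟨h1, h2⟩ := key t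
  have : s (m+t+k) = s (m+t+q+k) := by
    by_contra hne
    exact h2 ⟨_, h1, hne⟩
  rw [show m + k + t = m+t+k by omega, this]
  congr 1
  omega

lemma complexity_zero (s : ℕ → Fin 2) : complexity s 0 = 1 := by
  rw [complexity_eq]
  simp [window]

lemma le_complexity {s : ℕ → Fin 2} (hs : ¬ UltimatelyPeriodic s) (k : ℕ) :
    k + 1 ≤ complexity s k := by
  induction k with
  | zero => rw [complexity_zero]
  | succ k ih =>
    suffices complexity s k < complexity s (k+1) by omega
    by_contra hc
    have hno : ∀ a, ¬ RSp s k a := fun a ha => hc (lt_of_RSp ha)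
    obtain ⟨a, b, hab, he⟩ : ∃ a b, a < b ∧ WEq s k a b := by
      by_contra hne
      push Not at hne
      have : Function.Injective (fun i => window s i k) := by
        intro a b hab
        simp only [window_eq_iff] at hab
        rcases lt_trichotomy a b with h | h | h
        · exact absurd hab (hne a b h)
        · exact h
        · exact absurd hab.symm (hne b a h)
      exact Set.infinite_range_of_injective this (range_fin s k)
    obtain ⟨q, rfl⟩ := Nat.exists_eq_add_of_lt hab
    exact hs (periodic_of_det (q := q+1) (by omega) he (fun t _ => hno _))

lemma not_periodic {s : ℕ → Fin 2} (h : Sturmian s) : ¬ UltimatelyPeriodic s := by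
  rintro ⟨N, q, hq, hs⟩
  have h1 := h (N+q) (by omega)
  rw [complexity_eq] at h1
  have : Set.range (fun i => window s i (N+q)) ⊆
      ((Finset.range (N+q)).image (fun i => window s i (N+q)) : Finset _) := by
    rintro _ ⟨n, rfl⟩
    induction n using Nat.strong_induction_on with
    | _ n ih =>
      by_cases hn : n < N + q
      · simp only [Finset.coe_image, Set.mem_image, Finset.mem_coe, Finset.mem_range]
        exact ⟨n, hn, rfl⟩
      · have := ih (n-q) (by omega)
        have h2 : window s (n-q) (N+q) = window s n (N+q) := by
          rw [window_eq_iff]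
          intro j _
          rw [← hs (n-q+j) (by omega)]
          congr 1
          omega
        simp only at this
        rwa [h2] at this
  have h2 := Set.ncard_le_ncard this (Finset.finite_toSet _)
  rw [Set.ncard_coe_finset] at h2
  have h3 := Finset.card_image_le (s := Finset.range (N+q)) (f := fun i => window s i (N+q))
  rw [Finset.card_range] at h3
  omega

/-- The key step. -/
lemma key_contra {s : ℕ → Fin 2} (h : Sturmian s) {n j i : ℕ} (hn : 1 ≤ n)
    (hpal : ∀ k, 1 ≤ k → k < n → s (j+k) = s (j+(n-k))) (hend : s (j+n) = s j)
    (hns : ¬ RSp s n j) (hw : ∀ k, 1 ≤ k → k < n → s (j+k) = s (i+k))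
    (hne : s (j+n) ≠ s (i+n)) : False := by
  obtain ⟨m, rfl⟩ : ∃ m, n = m+1 := ⟨n-1, by omega⟩
  have hno : ∀ t ≤ m+1, ¬ RSp s (m+1) (j+t) := by
    intro t ht hR
    have hp : complexity s (m+1) ≤ complexity s m + 1 := by
      rcases m with _ | m
      · rw [complexity_zero, h 1 le_rfl]
      · rw [h (m+1) (by omega), h (m+2) (by omega)]
    have h1 : RSp s m (j+1) := by
      refine ⟨i+1, ?_, ?_⟩
      · intro k hk
        have := hw (k+1) (by omega) (by omega)
        rwa [show j+1+k = j+(k+1) by omega, show i+1+k = i+(k+1) by omega]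
      · rwa [show j+1+m = j+(m+1) by omega, show i+1+m = i+(m+1) by omega]
    have h2 : RSp s m (j+t+1) := by
      obtain ⟨b, hb, hb'⟩ := hR
      refine ⟨b+1, hb.tail, ?_⟩
      rwa [show j+t+1+m = j+t+(m+1) by omega, show b+1+m = b+(m+1) by omega]
    have h3 := RSp_unique h2 h1 hp
    have h4 : s (j+t) ≠ s j := by
      intro h4
      apply hns
      refine hR.congr ?_
      intro k hk
      rcases k with _ | k
      · exact h4
      · have := h3 k (by omega)
        rwa [show j+t+1+k = j+t+(k+1) by omega, show j+1+k = j+(k+1) by omega] at this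
    have ht0 : t ≠ 0 := by rintro rfl; exact h4 rfl
    have htn : t ≠ m+1 := by rintro rfl; exact h4 hend
    have h5 := h3 (m-t) (by omega)
    rw [show j+t+1+(m-t) = j+(m+1) by omega, show j+1+(m-t) = j+(m+1-t) by omega, hend,
      ← hpal t (by omega) (by omega)] at h5
    exact h4 h5.symm
  obtain ⟨a, ha⟩ : ∃ a, RSp s (m+1) a := by
    apply exists_RSp
    rw [h (m+1) (by omega), h (m+1+1) (by omega)]
    omega
  have hcard := h (m+1) (by omega)
  rw [complexity_eq] at hcard
  have h1 := Set.ncard_sdiff_singleton_add_one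
    (show window s a (m+1) ∈ Set.range (fun i => window s i (m+1)) from ⟨a, rfl⟩)
    (range_fin s (m+1))
  have hfin : (Set.range (fun i => window s i (m+1)) \ {window s a (m+1)}).Finite :=
    (range_fin s (m+1)).sdiff
  have hlt : hfin.toFinset.card < (Finset.range (m+1+1)).card := by
    rw [← Set.ncard_eq_toFinset_card _ hfin, Finset.card_range]
    omega
  obtain ⟨x, hx, y, hy, hxy, he⟩ := Finset.exists_ne_map_eq_of_card_lt_of_maps_to hlt
    (f := fun t => window s (j+t) (m+1)) (by
      intro t ht
      simp only [Finset.coe_range, Set.mem_Iio] at ht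
      simp only [Set.Finite.coe_toFinset]
      refine ⟨⟨j+t, rfl⟩, ?_⟩
      intro hh
      rw [Set.mem_singleton_iff, window_eq_iff] at hh
      exact hno t (by omega) (ha.congr hh.symm))
  simp only [Finset.mem_range, window_eq_iff] at hx hy he
  have fin : ∀ x y, x < y → y < m+1+1 → WEq s (m+1) (j+x) (j+y) → False := by
    intro x y hxy hy he
    refine not_periodic h (periodic_of_det (k := m+1) (m := j+x) (q := y-x) (by omega) ?_ ?_)
    · rwa [show j + x + (y-x) = j+y by omega]
    · intro t ht
      rw [add_assoc]
      exact hno _ (by omega)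
  rcases lt_or_gt_of_ne hxy with h6 | h6
  · exact fin x y h6 hy he
  · exact fin y x h6 hx he.symm

/-- prefix sums -/
def PS (s : ℕ → Fin 2) (n : ℕ) : ℤ := ∑ i ∈ Finset.range n, ((s i : ℕ) : ℤ)

lemma PS_succ (s : ℕ → Fin 2) (n : ℕ) : PS s (n+1) = PS s n + ((s n : ℕ) : ℤ) := by
  simp [PS, Finset.sum_range_succ]

lemma fin2_eq {a b : Fin 2} (h : ((a : ℕ) : ℤ) = ((b : ℕ) : ℤ)) : a = b := by
  apply Fin.ext; exact_mod_cast h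

lemma balanced {s : ℕ → Fin 2} (h : Sturmian s) (L : ℕ) : ∀ i j,
    PS s (j+L) - PS s j - (PS s (i+L) - PS s i) ≤ 1 := by
  induction L using Nat.strong_induction_on with
  | _ L ih =>
  intro i j
  by_contra hc
  push Not at hc
  have hL : 2 ≤ L := by
    by_contra hL
    have h1 := PS_succ s i
    have h2 := PS_succ s j
    have h3 := (s i).2
    have h4 := (s j).2
    interval_cases L
    · simp at hc
    · omega
  have hd : ∀ k, 1 ≤ k → k < L → PS s (j+k) - PS s j = PS s (i+k) - PS s i + 1 := by
    intro k hk hk'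
    have h1 := ih k hk' i j
    have h2 := ih (L-k) (by omega) (i+k) (j+k)
    rw [show i+k+(L-k) = i+L by omega, show j+k+(L-k) = j+L by omega] at h2
    omega
  have hdL : PS s (j+L) - PS s j = PS s (i+L) - PS s i + 2 := by
    have h1 := hd (L-1) (by omega) (by omega)
    have h2 := ih 1 (by omega) (i+(L-1)) (j+(L-1))
    rw [show i+(L-1)+1 = i+L by omega, show j+(L-1)+1 = j+L by omega] at h2
    omega
  obtain ⟨n, rfl⟩ : ∃ n, L = n+1 := ⟨L-1, by omega⟩
  -- letters
  have hj0 : ((s j : ℕ) : ℤ) = 1 ∧ ((s i : ℕ):ℤ) = 0 := by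
    have h1 := hd 1 (by omega) (by omega)
    rw [PS_succ, PS_succ] at h1
    have h3 := (s i).2
    have h4 := (s j).2
    omega
  have hjn : ((s (j+n) : ℕ) : ℤ) = 1 ∧ ((s (i+n) : ℕ):ℤ) = 0 := by
    have h1 := hd n (by omega) (by omega)
    rw [← add_assoc, ← add_assoc, PS_succ, PS_succ] at hdL
    have h3 := (s (i+n)).2
    have h4 := (s (j+n)).2
    omega
  have hmid : ∀ k, 1 ≤ k → k < n → s (j+k) = s (i+k) := by
    intro k hk hk'
    have h1 := hd k hk (by omega)
    have h2 := hd (k+1) (by omega) (by omega)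
    rw [← add_assoc, ← add_assoc, PS_succ, PS_succ] at h2
    apply fin2_eq
    omega
  have hpp : ∀ k, k < n → PS s (j+(k+1)) - PS s (j+1) = PS s (j+n) - PS s (j+(n-k)) := by
    intro k hk
    have h1 := ih (k+1) (by omega) (i+(n-k)) j
    have h2 := ih (k+1) (by omega) i (j+(n-k))
    rw [show i+(n-k)+(k+1) = i+n+1 by omega] at h1
    rw [show j+(n-k)+(k+1) = j+n+1 by omega] at h2
    rw [PS_succ] at h1 h2
    have h3 := hd (k+1) (by omega) (by omega)
    have h4 := hd (n-k) (by omega) (by omega)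
    have h5 := hd n (by omega) (by omega)
    have h6 := PS_succ s j
    omega
  have hpal : ∀ k, 1 ≤ k → k < n → s (j+k) = s (j+(n-k)) := by
    intro k hk hk'
    have h1 := hpp k hk'
    have h2 := hpp (k-1) (by omega)
    rw [← add_assoc, PS_succ s (j+k)] at h1
    rw [show j+(k-1+1) = j+k by omega, show j+(n-(k-1)) = j+(n-k)+1 by omega,
      PS_succ s (j+(n-k))] at h2
    apply fin2_eq
    omega
  have hpali : ∀ k, 1 ≤ k → k < n → s (i+k) = s (i+(n-k)) := by
    intro k hk hk'
    rw [← hmid k hk hk', ← hmid (n-k) (by omega) (by omega)]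
    exact hpal k hk hk'
  have hnen : s (j+n) ≠ s (i+n) := by
    intro hh
    rw [hh] at hjn
    omega
  by_cases hR : RSp s n j
  · by_cases hR' : RSp s n i
    · have h1 := RSp_unique hR hR' (by rw [h n (by omega), h (n+1) (by omega)])
      have h2 := h1 0 (by omega)
      simp only [add_zero] at h2
      rw [h2] at hj0
      omega
    · exact key_contra h (by omega) hpali (fin2_eq (by omega)) hR'
        (fun k h1 h2 => (hmid k h1 h2).symm) hnen.symm
  · exact key_contra h (by omega) hpal (fin2_eq (by omega)) hR hmid hnen

lemma mech_step (g : ℝ → ℤ) (hm : Monotone g) (h1 : ∀ (x : ℝ) (m : ℤ), g (x + m) = g x + m)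
    (α x : ℝ) : g (x + α) - g x = ⌊α⌋ ∨ g (x + α) - g x = ⌊α⌋ + 1 := by
  have h2 : g (x + (⌊α⌋ : ℤ)) ≤ g (x + α) := hm (by linarith [Int.floor_le α])
  have h3 : g (x + α) ≤ g (x + ((⌊α⌋ + 1 : ℤ) : ℝ)) :=
    hm (by push_cast; linarith [Int.lt_floor_add_one α])
  rw [h1] at h2 h3
  omega

lemma mech_sturmian (g : ℝ → ℤ) (hm : Monotone g)
    (h1 : ∀ (x : ℝ) (m : ℤ), g (x + m) = g x + m)
    (hb : ∀ x : ℝ, |(g x : ℝ) - x| ≤ 1) (α ρ : ℝ) (hα : Irrational α) (s : ℕ → Fin 2)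
    (hs : ∀ n : ℕ, s n = if g (((n : ℝ) + 1) * α + ρ) - g ((n : ℝ) * α + ρ) = ⌊α⌋
      then 0 else 1) : Sturmian s := by
  obtain ⟨G, hG⟩ : ∃ G : ℕ → ℤ, ∀ n, G n = g ((n : ℝ) * α + ρ) := ⟨_, fun _ => rfl⟩
  have hstep : ∀ n, G (n+1) = G n + ⌊α⌋ + ((s n : ℕ) : ℤ) := by
    intro n
    have h2 := mech_step g hm h1 α ((n : ℝ) * α + ρ)
    have h3 := hs n
    rw [show ((n : ℝ) + 1) * α + ρ = (n : ℝ) * α + ρ + α by ring] at h3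
    rw [hG, hG]
    push_cast
    rw [show ((n : ℝ) + 1) * α + ρ = (n : ℝ) * α + ρ + α by ring]
    rcases h2 with h2 | h2
    · rw [if_pos h2] at h3
      rw [h3]; simp; omega
    · rw [if_neg (by omega)] at h3
      rw [h3]; simp; omega
  have haper : ¬ UltimatelyPeriodic s := by
    rintro ⟨N, q, hq, hp⟩
    have hc : ∀ t, G (N+t+q) - G (N+t) = G (N+q) - G N := by
      intro t
      induction t with
      | zero => rfl
      | succ t ih =>
        have e1 := hstep (N+t)
        have e2 := hstep (N+t+q)
        rw [hp (N+t) (by omega)] at e2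
        rw [show N+(t+1)+q = N+t+q+1 by omega, show N+(t+1) = N+t+1 by omega]
        omega
    have hc2 : ∀ t : ℕ, G (N+t*q) = G N + t * (G (N+q) - G N) := by
      intro t
      induction t with
      | zero => simp
      | succ t ih =>
        have := hc (t*q)
        rw [show N+(t+1)*q = N+t*q+q by ring]
        push_cast
        linarith
    set c := G (N+q) - G N with hcdef
    have hne : (q : ℝ) * α - c ≠ 0 := by
      have := (hα.natCast_mul (m := q) (by omega)).sub_intCast c
      exact this.ne_zero
    obtain ⟨t, ht⟩ := exists_nat_gt (2 / |(q : ℝ) * α - c|)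
    rw [div_lt_iff₀ (abs_pos.2 hne)] at ht
    have b1 := hb ((N : ℝ) * α + ρ)
    have b2 := hb (((N + t*q : ℕ) : ℝ) * α + ρ)
    rw [← hG] at b1 b2
    rw [hc2] at b2
    push_cast at b2
    have b3 : (t : ℝ) * |(q : ℝ) * α - c| = |(t : ℝ) * ((q : ℝ) * α - c)| := by
      rw [abs_mul, Nat.abs_cast]
    rw [b3] at ht
    rw [abs_le] at b1 b2
    have : |(t : ℝ) * ((q : ℝ) * α - c)| ≤ 2 := by
      rw [abs_le]
      constructor <;> nlinarith
    linarith
  -- upper bound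
  intro k hk
  refine le_antisymm ?_ (le_complexity haper k)
  have hshift : ∀ n j : ℕ, g ((n : ℝ) * α + ρ - G n + j * α) = G (n+j) - G n := by
    intro n j
    have := h1 ((n : ℝ) * α + ρ + j * α) (-(G n))
    push_cast at this
    rw [show (n : ℝ) * α + ρ - G n + j * α = (n : ℝ) * α + ρ + j * α + -(G n : ℝ) by ring, this,
      hG (n+j)]
    push_cast
    rw [show (n : ℝ) * α + ρ + j * α = ((n : ℝ) + j) * α + ρ by ring]
    ring
  have hcmp : ∀ n m : ℕ, (n : ℝ) * α + ρ - G n ≤ (m : ℝ) * α + ρ - G m → ∀ j : ℕ,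
      G (n+j) - G n ≤ G (m+j) - G m ∧ G (m+j) - G m ≤ G (n+j) - G n + 1 := by
    intro n m hnm j
    have hlt : (m : ℝ) * α + ρ - G m ≤ (n : ℝ) * α + ρ - G n + 1 := by
      by_contra hh
      push Not at hh
      have e := hm hh.le
      have e1 := h1 ((n : ℝ) * α + ρ - G n) 1
      have e2 := hshift n 0
      have e3 := hshift m 0
      simp only [Nat.cast_zero, zero_mul, add_zero, sub_self, Int.cast_one] at e1 e2 e3
      omega
    constructor
    · rw [← hshift, ← hshift]
      exact hm (by linarith)
    · rw [← hshift, ← hshift]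
      have e1 := h1 ((n : ℝ) * α + ρ - G n + j * α) 1
      rw [← e1]
      refine hm ?_
      push_cast
      linarith
  obtain ⟨F, hF⟩ : ∃ F : ℕ → ℤ, ∀ n, F n = ∑ j ∈ Finset.range k, (G (n+(j+1)) - G n) :=
    ⟨_, fun _ => rfl⟩
  have hF1 : ∀ n m : ℕ, (n : ℝ) * α + ρ - G n ≤ (m : ℝ) * α + ρ - G m →
      F n ≤ F m ∧ F m ≤ F n + k ∧ (F n = F m → WEq s k n m) := by
    intro n m hnm
    refine ⟨?_, ?_, ?_⟩
    · rw [hF, hF]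
      exact Finset.sum_le_sum fun j _ => (hcmp n m hnm (j+1)).1
    · rw [hF, hF]
      calc ∑ j ∈ Finset.range k, (G (m+(j+1)) - G m)
          ≤ ∑ j ∈ Finset.range k, (G (n+(j+1)) - G n + 1) :=
            Finset.sum_le_sum fun j _ => (hcmp n m hnm (j+1)).2
        _ = _ := by simp [Finset.sum_add_distrib]
    · intro he
      rw [hF, hF, Finset.sum_eq_sum_iff_of_le
        (fun j _ => (hcmp n m hnm (j+1)).1)] at he
      have he' : ∀ j ≤ k, G (n+j) - G n = G (m+j) - G m := by
        intro j hj
        rcases j with _ | j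
        · simp
        · exact he j (Finset.mem_range.2 (by omega))
      intro j hj
      have e1 := he' j (by omega)
      have e2 := he' (j+1) (by omega)
      rw [← add_assoc, ← add_assoc, hstep, hstep] at e2
      apply fin2_eq
      omega
  have hF2 : ∀ n m : ℕ, F m ≤ F n + k ∧ (F n = F m → WEq s k n m) := by
    intro n m
    rcases le_total ((n : ℝ) * α + ρ - G n) ((m : ℝ) * α + ρ - G m) with h | h
    · exact (hF1 n m h).2
    · obtain ⟨a, b, c⟩ := hF1 m n h
      exact ⟨by omega, fun he => (c he.symm).symm⟩
  obtain ⟨lb, ⟨n0, hn0⟩, hmin⟩ := Int.exists_least_of_bdd (P := fun z => ∃ n, F n = z)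
    ⟨F 0 - k, by rintro _ ⟨n, rfl⟩; have := (hF2 n 0).1; omega⟩ ⟨F 0, 0, rfl⟩
  classical
  rw [complexity_eq]
  let φ : ℕ → List (Fin 2) := fun t =>
    if h : ∃ n, F n = lb + t then window s h.choose k else []
  have hsub : Set.range (fun i => window s i k) ⊆
      ((Finset.range (k+1)).image φ : Finset _) := by
    rintro _ ⟨n, rfl⟩
    have e1 := hmin _ ⟨n, rfl⟩
    have e2 := (hF2 n0 n).1
    simp only [Finset.coe_image, Set.mem_image, Finset.mem_coe, Finset.mem_range]
    refine ⟨(F n - lb).toNat, by omega, ?_⟩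
    have hex : ∃ n', F n' = lb + ((F n - lb).toNat : ℕ) := ⟨n, by omega⟩
    simp only [φ]
    rw [dif_pos hex, window_eq_iff]
    apply (hF2 _ _).2
    have := hex.choose_spec
    omega
  refine (Set.ncard_le_ncard hsub (Finset.finite_toSet _)).trans ?_
  rw [Set.ncard_coe_finset]
  exact Finset.card_image_le.trans (by simp)

lemma PS_add_nonneg (s : ℕ → Fin 2) (m k : ℕ) : 0 ≤ PS s (m+k) - PS s m ∧
    PS s (m+k) - PS s m ≤ k := by
  induction k with
  | zero => simp
  | succ k ih =>
    rw [← add_assoc, PS_succ]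
    have := (s (m+k)).2
    push_cast
    omega

lemma block {S : ℕ → ℤ} (hS : ∀ L i j, S (j+L) - S j - (S (i+L) - S i) ≤ 1) (m k t : ℕ) :
    (t : ℤ) * (S (m+k) - S m - 1) ≤ S (t*k) - S 0 ∧
    S (t*k) - S 0 ≤ (t : ℤ) * (S (m+k) - S m + 1) := by
  induction t with
  | zero => simp
  | succ t ih =>
    have a := hS k m (t*k)
    have b := hS k (t*k) m
    rw [show (t+1)*k = t*k+k by ring]
    push_cast
    constructor <;> nlinarith [ih.1, ih.2]

lemma exists_slope {S : ℕ → ℤ} (hS : ∀ L i j, S (j+L) - S j - (S (i+L) - S i) ≤ 1) :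
    ∃ α : ℝ, ∀ m k : ℕ, |(S (m+k) : ℝ) - S m - k * α| ≤ 1 := by
  have cross : ∀ m k n l : ℕ, 0 < k → 0 < l →
      ((S (m+k) : ℝ) - S m - 1) / k ≤ ((S (n+l) : ℝ) - S n + 1) / l := by
    intro m k n l hk hl
    have a := (block hS m k l).1
    have b := (block hS n l k).2
    rw [mul_comm k l] at b
    have c := a.trans b
    have c' : (l : ℝ) * ((S (m+k) : ℝ) - S m - 1) ≤ k * ((S (n+l) : ℝ) - S n + 1) := by
      exact_mod_cast c
    rw [div_le_div_iff₀ (by positivity) (by positivity)]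
    linarith
  let X : Set ℝ := {x | ∃ m k : ℕ, 0 < k ∧ x = ((S (m+k) : ℝ) - S m - 1) / k}
  have hne : X.Nonempty := ⟨_, 0, 1, one_pos, rfl⟩
  have hbd : BddAbove X := ⟨((S (0+1) : ℝ) - S 0 + 1) / (1 : ℕ), by
    rintro _ ⟨m, k, hk, rfl⟩
    exact cross m k 0 1 hk one_pos⟩
  refine ⟨sSup X, ?_⟩
  intro m k
  rcases Nat.eq_zero_or_pos k with rfl | hk
  · simp
  have hk' : (0 : ℝ) < k := by exact_mod_cast hk
  have a : ((S (m+k) : ℝ) - S m - 1) / k ≤ sSup X := le_csSup hbd ⟨m, k, hk, rfl⟩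
  have b : sSup X ≤ ((S (m+k) : ℝ) - S m + 1) / k := by
    apply csSup_le hne
    rintro _ ⟨n, l, hl, rfl⟩
    exact cross n l m k hl hk
  rw [div_le_iff₀ hk'] at a
  rw [le_div_iff₀ hk'] at b
  rw [abs_le]
  constructor <;> linarith

lemma stabilize (f : ℕ → ℤ) (hf : ∀ n, f n ≤ f (n+1)) (B : ℤ) (hB : ∀ n, f n ≤ B) :
    ∃ N, ∀ n ≥ N, f (n+1) = f n := by
  obtain ⟨ub, ⟨N, hN⟩, hmax⟩ := Int.exists_greatest_of_bdd (P := fun z => ∃ n, f n = z)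
    ⟨B, by rintro _ ⟨n, rfl⟩; exact hB n⟩ ⟨f 0, 0, rfl⟩
  have hmono : Monotone f := monotone_nat_of_le_succ hf
  refine ⟨N, fun n hn => ?_⟩
  have a := hmono hn
  have b := hmax _ ⟨n+1, rfl⟩
  have c := hf n
  omega

lemma slope_irrational {s : ℕ → Fin 2} (haper : ¬ UltimatelyPeriodic s)
    (hS : ∀ L i j, PS s (j+L) - PS s j - (PS s (i+L) - PS s i) ≤ 1) {α : ℝ}
    (hα : ∀ m k : ℕ, |(PS s (m+k) : ℝ) - PS s m - k * α| ≤ 1) : Irrational α := by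
  rintro ⟨r, rfl⟩
  apply haper
  set q := r.den with hq
  set p := r.num with hp
  have hqp : (q : ℝ) * (r : ℝ) = p := by
    have h : (q : ℚ) * r = p := by rw [mul_comm]; exact Rat.mul_den_eq_num r
    exact_mod_cast h
  obtain ⟨Φ, hΦ⟩ : ∃ Φ : ℕ → ℤ, ∀ n, Φ n = ∑ i ∈ Finset.range q, PS s (n+i) - n * p :=
    ⟨_, fun _ => rfl⟩
  have hstep : ∀ n, Φ (n+1) = Φ n + (PS s (n+q) - PS s n - p) := by
    intro n
    have e1 := Finset.sum_range_succ (fun i => PS s (n+i)) q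
    have e2 := Finset.sum_range_succ' (fun i => PS s (n+i)) q
    have e3 : ∑ i ∈ Finset.range q, PS s (n+1+i) = ∑ i ∈ Finset.range q, PS s (n+(i+1)) :=
      Finset.sum_congr rfl (fun i _ => by congr 1; omega)
    rw [hΦ, hΦ, e3]
    push_cast
    simp only [add_zero] at e2
    linarith
  have hbd : ∀ n, |Φ n - Φ 0| ≤ (q : ℤ) := by
    intro n
    have e : ((Φ n - Φ 0 : ℤ) : ℝ) =
        ∑ i ∈ Finset.range q, ((PS s (i+n) : ℝ) - PS s i - n * (r:ℝ)) := by
      rw [hΦ, hΦ]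
      push_cast
      rw [Finset.sum_sub_distrib, Finset.sum_sub_distrib, Finset.sum_const, Finset.card_range,
        nsmul_eq_mul, show (q : ℝ) * (n * (r : ℝ)) = n * p by rw [← hqp]; ring]
      simp only [zero_add, add_comm n]
      ring
    have e2 : |((Φ n - Φ 0 : ℤ) : ℝ)| ≤ q := by
      rw [e]
      refine (Finset.abs_sum_le_sum_abs _ _).trans ?_
      refine (Finset.sum_le_sum fun i _ => hα i n).trans ?_
      simp
    exact_mod_cast e2
  have hstab : ∃ N, ∀ n ≥ N, Φ (n+1) = Φ n := by
    by_cases hc : ∀ n, 0 ≤ PS s (n+q) - PS s n - p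
    · refine stabilize Φ (fun n => ?_) (Φ 0 + q) (fun n => ?_)
      · have := hc n; have := hstep n; omega
      · have := abs_le.1 (hbd n); omega
    · push Not at hc
      obtain ⟨n0, hn0⟩ := hc
      obtain ⟨N, hN⟩ := stabilize (fun n => - Φ n) (fun n => by
        have := hS q n0 n; have := hstep n; omega) (-(Φ 0) + q) (fun n => by
        have := abs_le.1 (hbd n); omega)
      exact ⟨N, fun n hn => by have := hN n hn; omega⟩
  obtain ⟨N, hN⟩ := hstab
  refine ⟨N, q, r.den_pos, fun n hn => ?_⟩
  have e1 := hN n hn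
  have e2 := hN (n+1) (by omega)
  rw [hstep] at e1
  rw [hstep (n+1), show n+1+q = n+q+1 by omega, PS_succ s (n+q), PS_succ s n] at e2
  apply fin2_eq
  omega

lemma sturmian_mech {s : ℕ → Fin 2} (h : Sturmian s) :
    ∃ α ρ : ℝ, Irrational α ∧ 0 < α ∧
        ((∀ n : ℕ,
            s n = if ⌊((n : ℝ) + 1) * α + ρ⌋ - ⌊(n : ℝ) * α + ρ⌋ = ⌊α⌋ then 0 else 1) ∨
         (∀ n : ℕ,
            s n = if ⌈((n : ℝ) + 1) * α + ρ⌉ - ⌈(n : ℝ) * α + ρ⌉ = ⌊α⌋ then 0 else 1)) := by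
  have hS := balanced h
  obtain ⟨α, hα⟩ := exists_slope hS
  have hirr := slope_irrational (not_periodic h) hS hα
  have hPS0 : PS s 0 = 0 := by simp [PS]
  have h0 : 0 < α := by
    rcases lt_trichotomy α 0 with hh | hh | hh
    · obtain ⟨k, hk⟩ := exists_nat_gt (1 / (-α))
      rw [div_lt_iff₀ (by linarith)] at hk
      have a := (abs_le.1 (hα 0 k)).2
      have b : (0 : ℝ) ≤ PS s (0+k) - PS s 0 := by exact_mod_cast (PS_add_nonneg s 0 k).1
      linarith
    · exact absurd hh hirr.ne_zero
    · exact hh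
  have h1 : α < 1 := by
    rcases lt_trichotomy α 1 with hh | hh | hh
    · exact hh
    · exact absurd hh hirr.ne_one
    · obtain ⟨k, hk⟩ := exists_nat_gt (1 / (α - 1))
      rw [div_lt_iff₀ (by linarith)] at hk
      have a := (abs_le.1 (hα 0 k)).1
      have b : (PS s (0+k) : ℝ) - PS s 0 ≤ k := by exact_mod_cast (PS_add_nonneg s 0 k).2
      linarith
  have hfl : ⌊α⌋ = 0 := Int.floor_eq_zero_iff.2 ⟨h0.le, h1⟩
  obtain ⟨D, hD⟩ : ∃ D : ℕ → ℝ, ∀ n, D n = PS s n - n * α := ⟨_, fun _ => rfl⟩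
  have hDD : ∀ n m, D n ≤ D m + 1 := by
    intro n m
    rw [hD, hD]
    rcases le_total n m with hh | hh <;> obtain ⟨k, rfl⟩ := Nat.exists_eq_add_of_le hh
    · have := (abs_le.1 (hα n k)).1
      push_cast; linarith
    · have := (abs_le.1 (hα m k)).2
      push_cast; linarith
  have hbdd : BddAbove (Set.range D) := ⟨D 0 + 1, by rintro _ ⟨n, rfl⟩; exact hDD n 0⟩
  set σ := sSup (Set.range D) with hσ
  have hup : ∀ n, D n ≤ σ := fun n => le_csSup hbdd ⟨n, rfl⟩
  have hlo : ∀ n, σ - 1 ≤ D n := by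
    intro n
    have : σ ≤ D n + 1 := csSup_le (Set.range_nonempty D) (by rintro _ ⟨m, rfl⟩; exact hDD m n)
    linarith
  have hfinal : ∀ n, s n = if PS s (n+1) - PS s n = ⌊α⌋ then 0 else 1 := by
    intro n
    rw [hfl, PS_succ]
    generalize s n = x
    fin_cases x <;> simp
  by_cases hc : ∀ n, σ - 1 < D n
  · refine ⟨α, σ, hirr, h0, Or.inl ?_⟩
    have hf : ∀ n : ℕ, ⌊(n : ℝ) * α + σ⌋ = PS s n := by
      intro n
      rw [Int.floor_eq_iff]
      have a := hc n
      have b := hup n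
      rw [hD] at a b
      constructor <;> linarith
    intro n
    have e := hf (n+1)
    push_cast at e
    rw [e, hf]
    exact hfinal n
  · push Not at hc
    obtain ⟨n0, hn0⟩ := hc
    refine ⟨α, σ - 1, hirr, h0, Or.inr ?_⟩
    have hlt : ∀ n, D n < σ := by
      intro n
      refine lt_of_le_of_ne (hup n) fun he => ?_
      have e1 : D n = D n0 + 1 := by linarith [hlo n0]
      rw [hD, hD] at e1
      have hne : (n0 : ℤ) - n ≠ 0 := by
        intro h3
        have : n0 = n := by omega
        subst this
        linarith
      have h4 := (hirr.intCast_mul hne).ne_int (PS s n0 - PS s n + 1)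
      apply h4
      push_cast
      linarith
    have hf : ∀ n : ℕ, ⌈(n : ℝ) * α + (σ - 1)⌉ = PS s n := by
      intro n
      rw [Int.ceil_eq_iff]
      have a := hlo n
      have b := hlt n
      rw [hD] at a b
      constructor <;> linarith
    intro n
    have e := hf (n+1)
    push_cast at e
    rw [e, hf]
    exact hfinal n

/-- A binary sequence is Sturmian iff it is a mechanical sequence of irrational
slope `α > 0` and some intercept `ρ` (lower or upper mechanical). -/
theorem stmt1 (s : ℕ → Fin 2) :
    Sturmian s ↔
      ∃ α ρ : ℝ, Irrational α ∧ 0 < α ∧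
        ((∀ n : ℕ,
            s n = if ⌊((n : ℝ) + 1) * α + ρ⌋ - ⌊(n : ℝ) * α + ρ⌋ = ⌊α⌋ then 0 else 1) ∨
         (∀ n : ℕ,
            s n = if ⌈((n : ℝ) + 1) * α + ρ⌉ - ⌈(n : ℝ) * α + ρ⌉ = ⌊α⌋ then 0 else 1)) := by
  constructor
  · exact sturmian_mech
  · rintro ⟨α, ρ, hα, -, hs | hs⟩
    · refine mech_sturmian (fun x => ⌊x⌋) Int.floor_mono (fun x m => Int.floor_add_intCast x m)
        (fun x => ?_) α ρ hα s hs
      rw [abs_le]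
      constructor <;> linarith [Int.floor_le x, Int.lt_floor_add_one x]
    · refine mech_sturmian (fun x => ⌈x⌉) Int.ceil_mono (fun x m => Int.ceil_add_intCast x m)
        (fun x => ?_) α ρ hα s hs
      rw [abs_le]
      constructor <;> linarith [Int.le_ceil x, Int.ceil_lt_add_one x]
end

section
/- Let s be an aperiodic sequence over a finite alphabet taking exactly a ≥ 2 distinct values, and suppose s admits at most one left special factor of each length. Then for all k ≥ 1 one has k + a − 1 ≤ p(k) ≤ (a − 1)k + 1, where p(k) is the number of distinct factors of s of length k. In particular, an aperiodic binary sequence with at most one left special factor of each length is Sturmian. -/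
theorem window_len {A : Type*} (s : ℕ → A) (i k : ℕ) : (window s i k).length = k := by
  simp [window]

theorem window_cons {A : Type*} (s : ℕ → A) (i k : ℕ) :
    window s i (k+1) = s i :: window s (i+1) k := by
  simp only [window, List.range_succ_eq_map, List.map_cons, List.map_map]
  congr 1
  apply List.map_congr_left
  intro j _
  simp only [Function.comp]
  congr 1
  omega

theorem window_snoc {A : Type*} (s : ℕ → A) (i k : ℕ) :
    window s i (k+1) = window s i k ++ [s (i+k)] := by
  simp [window, List.range_succ]

theorem factor_set {A : Type*} (s : ℕ → A) (k : ℕ) :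
    {l : List A | l.length = k ∧ IsFactor s l} = Set.range (fun i => window s i k) := by
  ext l
  constructor
  · rintro ⟨h, i, hi⟩
    exact ⟨i, by rw [hi, h]⟩
  · rintro ⟨i, rfl⟩
    exact ⟨window_len s i k, i, by simp only [window_len]⟩

theorem fin_F {A : Type*} (s : ℕ → A) (hfin : (Set.range s).Finite) (k : ℕ) :
    (Set.range (fun i => window s i k)).Finite := by
  induction k with
  | zero => exact (Set.finite_singleton ([] : List A)).subset (by rintro _ ⟨i, rfl⟩; simp [window])
  | succ k ih =>
    refine (Set.Finite.image2 List.cons hfin ih).subset ?_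
    rintro _ ⟨i, rfl⟩
    exact ⟨s i, ⟨i, rfl⟩, window s (i+1) k, ⟨i+1, rfl⟩, (window_cons s i k).symm⟩

theorem compl_zero {A : Type*} (s : ℕ → A) : complexity s 0 = 1 := by
  rw [complexity, factor_set]
  have : Set.range (fun i => window s i 0) = {([] : List A)} := by
    ext l; simp [window, eq_comm]
  rw [this, Set.ncard_singleton]

theorem compl_one {A : Type*} (s : ℕ → A) : complexity s 1 = (Set.range s).ncard := by
  rw [complexity, factor_set]
  have : Set.range (fun i => window s i 1) = (fun x => [x]) '' Set.range s := by
    rw [← Set.range_comp]; congr 1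
  rw [this, Set.ncard_image_of_injective]
  intro x y h
  simpa using h

theorem compl_lower {A : Type*} (s : ℕ → A) (hfin : (Set.range s).Finite)
    (hap : ¬ UltimatelyPeriodic s) (k : ℕ) : complexity s k + 1 ≤ complexity s (k+1) := by
  rw [complexity, complexity, factor_set, factor_set]
  by_contra hlt
  apply hap
  have himg : List.dropLast '' Set.range (fun i => window s i (k+1)) =
      Set.range (fun i => window s i k) := by
    rw [← Set.range_comp]; congr 1; funext i; simp [window_snoc]
  have hle := Set.ncard_image_le (f := List.dropLast) (fin_F s hfin (k+1))
  rw [himg] at hle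
  have hinj : Set.InjOn List.dropLast (Set.range (fun i => window s i (k+1))) := by
    apply Set.injOn_of_ncard_image_eq _ (fin_F s hfin (k+1))
    rw [himg]; omega
  have key : ∀ i j, window s i k = window s j k → window s i (k+1) = window s j (k+1) := by
    intro i j h
    apply hinj ⟨i, rfl⟩ ⟨j, rfl⟩
    simp [window_snoc, h]
  have hni : ¬ Function.Injective (fun i => window s i k) := by
    intro h
    exact Set.infinite_range_of_injective h (fin_F s hfin k)
  have : ∃ i j, i < j ∧ window s i k = window s j k := by
    simp only [Function.Injective, not_forall] at hni
    obtain ⟨i, j, h, hne⟩ := hni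
    rcases lt_or_gt_of_ne hne with h1 | h1
    · exact ⟨i, j, h1, h⟩
    · exact ⟨j, i, h1, h.symm⟩
  obtain ⟨i, j, hij, h⟩ := this
  have hn : ∀ n, window s (i+n) k = window s (j+n) k := by
    intro n
    induction n with
    | zero => exact h
    | succ n ih =>
      have := key _ _ ih
      rw [window_cons, window_cons] at this
      exact (List.cons.inj this).2
  refine ⟨i, j - i, by omega, ?_⟩
  intro n hn'
  have h3 := key _ _ (hn (n - i))
  rw [window_cons, window_cons] at h3
  have h4 := (List.cons.inj h3).1
  rw [show i + (n - i) = n by omega, show j + (n - i) = n + (j - i) by omega] at h4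
  exact h4.symm

theorem compl_upper {A : Type*} (s : ℕ → A) (hfin : (Set.range s).Finite)
    (hls : ∀ w w' : List A, w.length = w'.length →
      LeftSpecial s w → LeftSpecial s w' → w = w') (k : ℕ) :
    complexity s (k+1) ≤ complexity s k + ((Set.range s).ncard - 1) := by
  have hF : ∀ i k, IsFactor s (window s i k) := fun i k => ⟨i, by rw [window_len]⟩
  have htail : ∀ i j, window s (i+1) k = window s (j+1) k →
      ¬ LeftSpecial s (window s (i+1) k) → window s i (k+1) = window s j (k+1) := by
    intro i j h hn
    by_contra hne
    apply hn
    refine ⟨s i, s j, ?_, ?_, ?_⟩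
    · intro h'; apply hne; rw [window_cons, window_cons, h, h']
    · rw [← window_cons]; exact hF _ _
    · rw [h, ← window_cons]; exact hF _ _
  rw [complexity, complexity, factor_set, factor_set]
  by_cases hex : ∃ i, LeftSpecial s (window s (i+1) k)
  · obtain ⟨i0, h0⟩ := hex
    set w := window s (i0+1) k with hw
    have hsub : Set.range (fun i => window s i (k+1)) ⊆
        ((fun x => x :: w) '' Set.range s) ∪
          {l ∈ Set.range (fun i => window s i (k+1)) | l.tail ≠ w} := by
      rintro _ ⟨i, rfl⟩
      by_cases h : window s (i+1) k = w
      · left; exact ⟨s i, ⟨i, rfl⟩, by simp only [window_cons, h]⟩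
      · right; exact ⟨⟨i, rfl⟩, by simpa only [window_cons, List.tail_cons] using h⟩
    have hf2 : {l ∈ Set.range (fun i => window s i (k+1)) | l.tail ≠ w}.Finite :=
      (fin_F s hfin (k+1)).subset (Set.sep_subset _ _)
    have h1 := Set.ncard_le_ncard hsub ((hfin.image _).union hf2)
    have h2 := Set.ncard_union_le ((fun x => x :: w) '' Set.range s)
      {l ∈ Set.range (fun i => window s i (k+1)) | l.tail ≠ w}
    have h3 := Set.ncard_image_le (f := fun x => x :: w) hfin
    have hmem : w ∈ Set.range (fun i => window s i k) := ⟨i0+1, rfl⟩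
    have h4 : {l ∈ Set.range (fun i => window s i (k+1)) | l.tail ≠ w}.ncard ≤
        (Set.range (fun i => window s i k) \ {w}).ncard := by
      refine Set.ncard_le_ncard_of_injOn List.tail ?_ ?_ ?_
      · rintro _ ⟨⟨i, rfl⟩, h⟩
        refine ⟨⟨i+1, ?_⟩, h⟩
        simp [window_cons]
      · rintro _ ⟨⟨i, rfl⟩, h⟩ _ ⟨⟨j, rfl⟩, h'⟩ he
        simp only [window_cons, List.tail_cons] at he h
        apply htail i j he
        intro hl
        exact h (hls _ _ (by rw [hw, window_len, window_len]) hl h0)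
      · exact (fin_F s hfin k).subset Set.sdiff_subset
    rw [Set.ncard_sdiff_singleton_of_mem hmem] at h4
    have h5 : 0 < (Set.range (fun i => window s i k)).ncard :=
      (Set.ncard_pos (fin_F s hfin k)).2 ⟨w, hmem⟩
    have h6 : 0 < (Set.range s).ncard := (Set.ncard_pos hfin).2 ⟨s 0, 0, rfl⟩
    omega
  · push Not at hex
    refine le_trans ?_ (Nat.le_add_right _ _)
    refine Set.ncard_le_ncard_of_injOn List.tail ?_ ?_ ?_
    · rintro _ ⟨i, rfl⟩
      exact ⟨i+1, by simp [window_cons]⟩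
    · rintro _ ⟨i, rfl⟩ _ ⟨j, rfl⟩ he
      simp only [window_cons, List.tail_cons] at he
      exact htail i j he (hex i)
    · exact fin_F s hfin k

theorem bounds {A : Type*} (s : ℕ → A) (hfin : (Set.range s).Finite)
    (hap : ¬ UltimatelyPeriodic s)
    (hls : ∀ w w' : List A, w.length = w'.length →
      LeftSpecial s w → LeftSpecial s w' → w = w') (k : ℕ) (hk : 1 ≤ k) :
    k + (Set.range s).ncard - 1 ≤ complexity s k ∧
      complexity s k ≤ ((Set.range s).ncard - 1) * k + 1 := by
  have h6 : 0 < (Set.range s).ncard := (Set.ncard_pos hfin).2 ⟨s 0, 0, rfl⟩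
  induction k, hk using Nat.le_induction with
  | base => rw [compl_one]; omega
  | succ k hk ih =>
    have h1 := compl_lower s hfin hap k
    have h2 := compl_upper s hfin hls k
    rw [Nat.mul_succ]
    omega

/-- An aperiodic sequence taking exactly `a ≥ 2` values with at most one left
special factor of each length satisfies `k + a - 1 ≤ p(k) ≤ (a-1)k + 1`; in
particular an aperiodic binary sequence with at most one left special factor of
each length is Sturmian. -/
theorem stmt3 {A : Type*} (s : ℕ → A) (a : ℕ) (ha : 2 ≤ a)
    (hfin : (Set.range s).Finite) (hcard : (Set.range s).ncard = a)
    (hap : ¬ UltimatelyPeriodic s)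
    (hls : ∀ w w' : List A, w.length = w'.length →
      LeftSpecial s w → LeftSpecial s w' → w = w') :
    (∀ k ≥ 1, k + a - 1 ≤ complexity s k ∧ complexity s k ≤ (a - 1) * k + 1) ∧
    (∀ t : ℕ → Fin 2, ¬ UltimatelyPeriodic t →
      (∀ w w' : List (Fin 2), w.length = w'.length →
        LeftSpecial t w → LeftSpecial t w' → w = w') →
      Sturmian t) := by
  subst hcard
  refine ⟨fun k hk => bounds s hfin hap hls k hk, ?_⟩
  intro t ht hl k hk
  have hf : (Set.range t).Finite := Set.toFinite _
  have h1 := compl_lower t hf ht 0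
  rw [compl_zero, compl_one] at h1
  have h2 : (Set.range t).ncard ≤ 2 := by
    have := Set.ncard_le_ncard (Set.subset_univ (Set.range t)) Set.finite_univ
    simpa [Set.ncard_univ] using this
  have h3 : (Set.range t).ncard = 2 := by omega
  have h4 := bounds t hf ht hl k hk
  rw [h3] at h4
  omega
end
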